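/- Let M be a compact, connected topological 3-manifold without boundary that is not homeomorphic to the 3-sphere S³, and let k be a knot in M (a topological embedding of S¹ into M). Suppose there is a topological embedding e of the closed unit ball of ℝ³ into M such that the image of k is contained in the image under e of the open unit ball. Then k is not irreducible: there exists a topological embedding of the 2-sphere S² into M \ k(S¹) (namely the restriction of e to the boundary sphere) whose image does not bound a ball in M \ k(S¹), i.e., there is no topological embedding f of the closed unit ball of ℝ³ into M with image disjoint from k(S¹) away from the sphere and whose restriction to the boundary sphere has the same image as that embedded sphere. -/

import Mathlib

open Set Metric Topology MeasureTheory Filter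
open scoped NNReal

section Brouwer

variable {E : Type*} [NormedAddCommGroup E] [InnerProductSpace ℝ E] [FiniteDimensional ℝ E]

/-- `t ↦ det (1 + t A)` is a polynomial of degree at most `dim E`. -/
theorem exists_polynomial_det_one_add_smul (A : E →L[ℝ] E) :
    ∃ p : Polynomial ℝ, p.natDegree ≤ Module.finrank ℝ E ∧
      ∀ t : ℝ, p.eval t = (ContinuousLinearMap.id ℝ E + t • A).det := by
  let b := Module.finBasis ℝ E
  let a := LinearMap.toMatrix b b (A : E →ₗ[ℝ] E)
  refine ⟨((Polynomial.X : Polynomial ℝ) • a.map Polynomial.C +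
    (1 : Matrix _ _ ℝ).map Polynomial.C).det, ?_, fun t ↦ ?_⟩
  · simpa using Polynomial.natDegree_det_X_add_C_le a 1
  · rw [ContinuousLinearMap.det, ← LinearMap.det_toMatrix b, ← Polynomial.coe_evalRingHom,
      RingHom.map_det]
    congr 1
    ext i j
    by_cases h : i = j
    · simp [a, LinearMap.toMatrix_apply, h]
      ring
    · simp [a, LinearMap.toMatrix_apply, h]
      ring

/-- A map `id + t u` with `u` Lipschitz, `u = 0` on the unit sphere and `t` small is a bijection of
the open unit ball. -/
theorem image_ball_eq_of_lipschitz {u : E → E} {K : ℝ≥0} (hK : LipschitzOnWith K u (closedBall 0 1))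
    (hu : ∀ x, ‖x + u x‖ ≤ 1) (hu0 : ∀ x, ‖x‖ = 1 → u x = 0) {t : ℝ} (ht0 : 0 < t) (ht1 : t < 1)
    (htK : t * K < 1) :
    InjOn (fun x ↦ x + t • u x) (ball 0 1) ∧ (fun x ↦ x + t • u x) '' ball 0 1 = ball 0 1 := by
  set f : E → E := fun x ↦ x + t • u x with hf
  let c : ℝ≥0 := ⟨t * K, by positivity⟩
  have hsub : ball (0 : E) 1 ⊆ closedBall 0 1 := ball_subset_closedBall
  have happ : ApproximatesLinearOn f (ContinuousLinearEquiv.refl ℝ E : E →L[ℝ] E) (ball 0 1) c := by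
    intro x hx y hy
    have h := hK.norm_sub_le (hsub hx) (hsub hy)
    have e : f x - f y - (ContinuousLinearEquiv.refl ℝ E : E →L[ℝ] E) (x - y)
        = t • (u x - u y) := by
      simp [hf, smul_sub]; abel
    rw [e, norm_smul, Real.norm_of_nonneg ht0.le]
    calc t * ‖u x - u y‖ ≤ t * (K * ‖x - y‖) := by gcongr
      _ = c * ‖x - y‖ := (mul_assoc _ _ _).symm
  have hinj : InjOn f (ball 0 1) := by
    intro x hx y hy hxy
    have h := happ x hx y hy
    rw [hxy, sub_self, zero_sub, norm_neg] at h
    simp only [ContinuousLinearEquiv.coe_coe, ContinuousLinearEquiv.coe_refl', id] at h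
    change _ ≤ t * K * _ at h
    have : ‖x - y‖ = 0 := by nlinarith [norm_nonneg (x - y)]
    exact sub_eq_zero.1 (norm_eq_zero.1 this)
  refine ⟨hinj, ?_⟩
  have hmaps : ∀ x, ‖x‖ < 1 → ‖f x‖ < 1 := by
    intro x hx
    have : f x = (1 - t) • x + t • (x + u x) := by simp only [hf]; module
    rw [this]
    calc _ ≤ (1 - t) * ‖x‖ + t * ‖x + u x‖ := by
          refine (norm_add_le _ _).trans (le_of_eq ?_)
          rw [norm_smul, norm_smul, Real.norm_of_nonneg ht0.le,
            Real.norm_of_nonneg (sub_nonneg.2 ht1.le)]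
      _ < 1 := by nlinarith [hu x]
  have hopen : IsOpen (f '' ball 0 1) := by
    refine happ.open_image (ContinuousLinearEquiv.refl ℝ E).toNonlinearRightInverse isOpen_ball ?_
    rcases subsingleton_or_nontrivial E with h | h
    · exact Or.inl h
    · right
      change c < ‖((ContinuousLinearEquiv.refl ℝ E).symm : E →L[ℝ] E)‖₊⁻¹
      have : ‖((ContinuousLinearEquiv.refl ℝ E).symm : E →L[ℝ] E)‖₊ = 1 :=
        NNReal.eq (ContinuousLinearMap.norm_id (𝕜 := ℝ) (E := E))
      rw [this, inv_one]
      exact htK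
  apply Subset.antisymm
  · rintro _ ⟨x, hx, rfl⟩
    simpa using hmaps x (by simpa using hx)
  · refine (convex_ball (0 : E) 1).isPreconnected.subset_of_closure_inter_subset hopen
      ⟨f 0, by simpa using hmaps 0 (by simp), mem_image_of_mem f (by simp)⟩ ?_
    have hcont : ContinuousOn f (closedBall 0 1) :=
      continuousOn_id.add (hK.continuousOn.const_smul t)
    rintro y ⟨hy, hy1⟩
    have hcl : closure (f '' ball 0 1) ⊆ f '' closedBall 0 1 :=
      closure_minimal (image_mono hsub)
        ((isCompact_closedBall (0 : E) 1).image_of_continuousOn hcont).isClosed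
    obtain ⟨x, hx, rfl⟩ := hcl hy
    rcases (mem_closedBall_zero_iff.1 hx).lt_or_eq with h | h
    · exact mem_image_of_mem f (by simpa using h)
    · simp [hf, hu0 x h, h] at hy1

/-- There is no `C¹` retraction of the unit ball onto the unit sphere. -/
theorem not_exists_contDiff_retraction_sphere {r : E → E} (hr : ContDiff ℝ 1 r)
    (hr1 : ∀ x, ‖r x‖ = 1) (hrs : ∀ x, ‖x‖ = 1 → r x = x) : False := by
  borelize E
  let μ : Measure E := volume
  let u : E → E := fun x ↦ r x - x
  have hu : ContDiff ℝ 1 u := hr.sub contDiff_id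
  have hfd : Continuous (fderiv ℝ u) := hu.continuous_fderiv (by norm_num)
  obtain ⟨K, hK⟩ : ∃ K : ℝ≥0, LipschitzOnWith K u (closedBall 0 1) :=
    hu.locallyLipschitz.locallyLipschitzOn.exists_lipschitzOnWith_of_compact
      (isCompact_closedBall _ _)
  let d : ℝ → E → ℝ := fun t x ↦ (ContinuousLinearMap.id ℝ E + t • fderiv ℝ u x).det
  have hd : Continuous fun z : ℝ × E ↦ d z.1 z.2 := by
    refine ContinuousLinearMap.continuous_det.comp ?_
    exact continuous_const.add (continuous_fst.smul (hfd.comp continuous_snd))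
  have hpos : ∀ᶠ t : ℝ in 𝓝 0, ∀ x ∈ closedBall (0 : E) 1, 0 < d t x := by
    refine (isCompact_closedBall (0 : E) 1).eventually_forall_of_forall_eventually fun x _ ↦ ?_
    refine hd.continuousAt.eventually (lt_mem_nhds ?_)
    simp [d, ContinuousLinearMap.det]
  have hsmall : ∀ᶠ t : ℝ in 𝓝[>] 0, (∫ x in ball (0 : E) 1, d t x ∂μ) = μ.real (ball 0 1) := by
    have h1 : ∀ᶠ t : ℝ in 𝓝 0, t < 1 := gt_mem_nhds one_pos
    have h2 : ∀ᶠ t : ℝ in 𝓝 0, t * K < 1 := by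
      have : Continuous fun t : ℝ ↦ t * K := by fun_prop
      exact this.continuousAt.eventually (gt_mem_nhds (by simp))
    filter_upwards [self_mem_nhdsWithin, nhdsWithin_le_nhds hpos, nhdsWithin_le_nhds h1,
      nhdsWithin_le_nhds h2] with t ht0 htd ht1 htK
    obtain ⟨hinj, himg⟩ := image_ball_eq_of_lipschitz hK (fun x ↦ by simp [u, hr1])
      (fun x hx ↦ by simp [u, hrs x hx]) ht0 ht1 htK
    have := integral_image_eq_integral_abs_det_fderiv_smul μ measurableSet_ball
      (f' := fun x ↦ ContinuousLinearMap.id ℝ E + t • fderiv ℝ u x)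
      (fun x _ ↦ ((hasFDerivAt_id x).add
        ((hu.differentiable (by norm_num) x).hasFDerivAt.const_smul t)).hasFDerivWithinAt)
      hinj (fun _ ↦ (1 : ℝ))
    change ∫ x in (fun x ↦ x + t • u x) '' ball 0 1, (1 : ℝ) ∂μ = _ at this
    rw [himg] at this
    simp only [smul_eq_mul, mul_one, integral_const, MeasurableSet.univ, measureReal_restrict_apply,
      univ_inter] at this
    rw [this]
    refine setIntegral_congr_fun measurableSet_ball fun x hx ↦ ?_
    exact (abs_of_pos (htd x (ball_subset_closedBall hx))).symm
  have hone : ∀ x, d 1 x = 0 := by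
    intro x
    by_contra h
    obtain ⟨v, hv⟩ := ((Module.End.isUnit_iff _).1
      ((LinearMap.isUnit_iff_isUnit_det _).2 (isUnit_iff_ne_zero.2 h))).2 (r x)
    have hru : r = fun x ↦ x + u x := by ext; simp [u]
    have hder : HasFDerivAt r (ContinuousLinearMap.id ℝ E + (1 : ℝ) • fderiv ℝ u x) x := by
      rw [one_smul]
      conv => arg 1; rw [hru]
      exact (hasFDerivAt_id x).add (hu.differentiable (by norm_num) x).hasFDerivAt
    rw [ContinuousLinearMap.coe_coe] at hv
    generalize ContinuousLinearMap.id ℝ E + (1 : ℝ) • fderiv ℝ u x = L at hv hder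
    have h1 := hder.norm_sq
    have h2 : HasFDerivAt (fun y ↦ ‖r y‖ ^ 2) (0 : E →L[ℝ] ℝ) x := by
      simp only [hr1]; exact hasFDerivAt_const _ _
    have h3 := congrArg (fun L : E →L[ℝ] ℝ ↦ L v) (h1.unique h2)
    simp [hv, hr1] at h3
  obtain ⟨ε, hε, hεd⟩ := mem_nhdsGT_iff_exists_Ioo_subset.1 hsmall
  obtain ⟨s, hs, hcard⟩ := (Ioo_infinite (mem_Ioi.1 hε)).exists_subset_card_eq
    (Module.finrank ℝ E + 1)
  let ℓ : ℝ → ℝ := fun i ↦ (Lagrange.basis s id i).eval 1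
  have hsum : ∑ i ∈ s, ℓ i = 1 := by
    have h := congrArg (Polynomial.eval 1) (Lagrange.sum_basis (s := s) (v := (id : ℝ → ℝ))
      (injOn_id _) (Finset.card_pos.1 (by omega)))
    simpa [Polynomial.eval_finsetSum] using h
  have hinterp : ∀ x, ∑ i ∈ s, d i x * ℓ i = 0 := by
    intro x
    obtain ⟨p, hp, hpd⟩ := exists_polynomial_det_one_add_smul (fderiv ℝ u x)
    have h := Lagrange.eq_interpolate_of_eval_eq (s := s) (v := (id : ℝ → ℝ)) (f := p)
      (fun i ↦ d i x) (injOn_id _)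
      (Polynomial.degree_le_natDegree.trans_lt (by rw [hcard]; exact_mod_cast Nat.lt_succ_of_le hp))
      (fun i _ ↦ hpd i)
    rw [← hone x, show d 1 x = p.eval 1 from (hpd 1).symm, h, Lagrange.interpolate_apply]
    simp [Polynomial.eval_finsetSum, ℓ]
  have hint : ∀ i, IntegrableOn (d i) (ball 0 1) μ := fun i ↦
    (((hd.comp (Continuous.prodMk_right i)).continuousOn).integrableOn_compact
      (isCompact_closedBall (0 : E) 1)).mono_set ball_subset_closedBall
  have hvol : μ.real (ball (0 : E) 1) = 0 := by
    calc μ.real (ball (0 : E) 1) = ∑ i ∈ s, (∫ x in ball (0 : E) 1, d i x ∂μ) * ℓ i := by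
          rw [Finset.sum_congr rfl fun i hi ↦ by rw [show _ = _ from hεd (hs hi)],
            ← Finset.mul_sum, hsum, mul_one]
      _ = ∫ x in ball (0 : E) 1, ∑ i ∈ s, d i x * ℓ i ∂μ := by
          rw [integral_finsetSum _ fun i _ ↦ (hint i).mul_const _]
          simp_rw [integral_mul_const]
      _ = 0 := by simp [hinterp]
  exact (ENNReal.toReal_pos (measure_ball_pos μ (0 : E) one_pos).ne'
    measure_ball_lt_top.ne).ne' hvol

/-- A continuous self-map of `E` which is the identity away from the open unit ball has a zero. -/
theorem exists_eq_zero_of_eq_self {f : E → E} (hf : Continuous f) (hfe : ∀ x, 1 ≤ ‖x‖ → f x = x) :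
    ∃ x, f x = 0 := by
  by_contra! h
  obtain ⟨c, hc, hcf⟩ : ∃ c > 0, ∀ x, c ≤ ‖f x‖ := by
    obtain ⟨x, -, hx⟩ := (isCompact_closedBall (0 : E) 1).exists_isMinOn ⟨0, by simp⟩
      hf.norm.continuousOn
    refine ⟨min ‖f x‖ 1, lt_min (norm_pos_iff.2 (h x)) one_pos, fun y ↦ ?_⟩
    rcases le_total ‖y‖ 1 with hy | hy
    · exact (min_le_left _ _).trans (hx (by simpa using hy))
    · rw [hfe y hy]; exact (min_le_right _ _).trans hy
  have hU : {x : E | 1 < ‖x‖} ∈ 𝓝ˢ {x : E | 2 ≤ ‖x‖} :=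
    (isOpen_lt continuous_const continuous_norm).mem_nhdsSet.2
      fun x (hx : 2 ≤ ‖x‖) ↦ show 1 < ‖x‖ by linarith
  obtain ⟨g, hg, hgf, hgS, -⟩ := hf.exists_contDiff_approx_and_eqOn 1 (continuous_const (y := c))
    (fun _ ↦ hc) (isClosed_le continuous_const continuous_norm) hU
    (contDiffOn_id.congr fun x (hx : 1 < ‖x‖) ↦ hfe x hx.le)
  have hg0 : ∀ x, g x ≠ 0 := by
    intro x hx
    have := hgf x
    rw [hx, dist_zero_left] at this
    exact this.not_ge (hcf x)
  have hg2 : ContDiff ℝ 1 fun x : E ↦ g ((2 : ℝ) • x) := hg.comp (contDiff_id.const_smul _)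
  refine not_exists_contDiff_retraction_sphere
    (r := fun x ↦ ‖g ((2 : ℝ) • x)‖⁻¹ • g ((2 : ℝ) • x))
    (((hg2.norm ℝ fun x ↦ hg0 _).inv fun x ↦ norm_ne_zero_iff.2 (hg0 _)).smul hg2) (fun x ↦ ?_)
    (fun x hx ↦ ?_)
  · simp [norm_smul, hg0]
  · have h2 : ‖(2 : ℝ) • x‖ = 2 := by simp [norm_smul, hx]
    have : g ((2 : ℝ) • x) = (2 : ℝ) • x := by
      rw [hgS (show (2 : ℝ) • x ∈ {x : E | 2 ≤ ‖x‖} from h2.ge), hfe _ (by rw [h2]; norm_num)]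
    simp only [this, h2, smul_smul]
    norm_num

/-- **Brouwer fixed point theorem** for the closed unit ball of a Euclidean space. -/
theorem exists_fixedPoint_closedBall {w : E → E} (hw : ContinuousOn w (closedBall 0 1))
    (hw1 : MapsTo w (closedBall 0 1) (closedBall 0 1)) : ∃ x ∈ closedBall (0 : E) 1, w x = x := by
  let π : E → E := fun x ↦ (max 1 ‖x‖)⁻¹ • x
  have hmax : ∀ x : E, 0 < max 1 ‖x‖ := fun x ↦ lt_max_of_lt_left one_pos
  have hπ : Continuous π :=
    ((continuous_const.max continuous_norm).inv₀ fun x ↦ (hmax x).ne').smul continuous_id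
  have hπB : ∀ x, π x ∈ closedBall (0 : E) 1 := by
    intro x
    rw [mem_closedBall_zero_iff, norm_smul, norm_inv, Real.norm_of_nonneg (hmax x).le,
      inv_mul_le_one₀ (hmax x)]
    exact le_max_right _ _
  let a : E → ℝ := fun x ↦ max 0 (min 1 (2 - ‖x‖))
  have ha0 : ∀ x, 0 ≤ a x := fun x ↦ le_max_left _ _
  have ha1 : ∀ x, a x ≤ 1 := fun x ↦ max_le zero_le_one (min_le_left _ _)
  have hW : Continuous fun x ↦
      (2 : ℝ)⁻¹ • ((2 : ℝ) • x - a ((2 : ℝ) • x) • w (π ((2 : ℝ) • x))) := by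
    have h2 : Continuous fun x : E ↦ (2 : ℝ) • x := continuous_id.const_smul 2
    have ha : Continuous a := by fun_prop
    exact (h2.sub ((ha.comp h2).smul ((hw.comp_continuous hπ hπB).comp h2))).const_smul _
  obtain ⟨z, hz⟩ := exists_eq_zero_of_eq_self hW (by
    intro x hx
    have : a ((2 : ℝ) • x) = 0 := by
      simp only [a, norm_smul, Real.norm_ofNat]
      exact max_eq_left ((min_le_right _ _).trans (by linarith))
    simp [this, smul_smul])
  have hz' := sub_eq_zero.1 ((smul_eq_zero.1 hz).resolve_left (by norm_num))
  set y := (2 : ℝ) • z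
  have hy : ‖y‖ ≤ 1 := by
    rw [hz', norm_smul, Real.norm_of_nonneg (ha0 _)]
    exact mul_le_one₀ (ha1 _) (norm_nonneg _) (by simpa using hw1 (hπB y))
  have hπy : π y = y := by simp [π, max_eq_left hy]
  have hay : a y = 1 := by
    simp only [a]
    rw [min_eq_left (by linarith), max_eq_right zero_le_one]
  refine ⟨y, by simpa using hy, ?_⟩
  rw [hay, one_smul, hπy] at hz'
  exact hz'.symm

/-- A continuous injective map on the closed unit ball sends `0` to an interior point of the
image. -/
theorem image_closedBall_mem_nhds {f : E → E} (hf : ContinuousOn f (closedBall 0 1))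
    (hinj : InjOn f (closedBall 0 1)) : f '' closedBall 0 1 ∈ 𝓝 (f 0) := by
  borelize E
  have hB : IsCompact (closedBall (0 : E) 1) := isCompact_closedBall _ _
  set K := f '' closedBall 0 1 with hKdef
  have hK : IsCompact K := hB.image_of_continuousOn hf
  have h0 : (0 : E) ∈ closedBall (0 : E) 1 := by simp
  obtain ⟨G, hG⟩ : ∃ G : C(E, E), ∀ x ∈ closedBall (0 : E) 1, G (f x) = x := by
    have := isCompact_iff_compactSpace.1 hB
    have : TietzeExtension E := TietzeExtension.of_tvs ℝ
    obtain ⟨G, hG⟩ := ContinuousMap.exists_extension' (Y := E)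
      (hf.domRestrict.isClosedEmbedding (injOn_iff_injective.1 hinj))
      ⟨Subtype.val, continuous_subtype_val⟩
    exact ⟨G, fun x hx ↦ congrFun hG ⟨x, hx⟩⟩
  by_contra hcon
  obtain ⟨ε, hε, hGε⟩ : ∃ ε > 0, ∀ y, ‖y - f 0‖ < 3 * ε → ‖G y‖ < 1 / 4 := by
    have : ∀ᶠ y in 𝓝 (f 0), ‖G y‖ < 1 / 4 :=
      G.continuous.norm.continuousAt.eventually (gt_mem_nhds (by simp [hG 0 h0]))
    obtain ⟨ε, hε, h⟩ := Metric.eventually_nhds_iff.1 this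
    exact ⟨ε / 3, by positivity, fun y hy ↦ h (by rw [dist_eq_norm]; linarith)⟩
  obtain ⟨c, hcε, hcK⟩ : ∃ c ∈ ball (f 0) ε, c ∉ K := by
    by_contra! h
    exact hcon (mem_of_superset (ball_mem_nhds _ hε) h)
  rw [mem_ball, dist_eq_norm] at hcε
  let S : Set E := K ∩ {y | ε ≤ ‖y - c‖}
  have hS : IsCompact S := hK.inter_right
    (isClosed_le continuous_const (continuous_id.sub continuous_const).norm)
  obtain ⟨δ, hδ, hδ4, hδS⟩ : ∃ δ > 0, δ ≤ 1 / 4 ∧ ∀ y ∈ S, δ ≤ ‖G y‖ := by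
    rcases S.eq_empty_or_nonempty with hS0 | hS0
    · exact ⟨1 / 4, by norm_num, le_rfl, by simp [hS0]⟩
    · obtain ⟨y, hy, hmin⟩ := hS.exists_isMinOn hS0 G.continuous.norm.continuousOn
      refine ⟨min ‖G y‖ (1 / 4), lt_min (norm_pos_iff.2 fun h ↦ ?_) (by norm_num),
        min_le_right _ _, fun z hz ↦ (min_le_left _ _).trans (hmin hz)⟩
      obtain ⟨⟨x, hx, rfl⟩, hxc : ε ≤ _⟩ := hy
      rw [hG x hx] at h
      rw [h, norm_sub_rev] at hxc
      exact hxc.not_gt hcε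
  obtain ⟨P₀, hP₀, hP₀G, -⟩ := G.continuous.exists_contDiff_approx 1
    (continuous_const (y := δ / 2)) (fun _ ↦ by positivity)
  obtain ⟨v, hvδ, hv⟩ : ∃ v ∈ ball (0 : E) (δ / 2), v ∉ P₀ '' sphere c ε := by
    by_contra! h
    have hnull : (volume : Measure E) (P₀ '' sphere c ε) = 0 :=
      addHaar_image_eq_zero_of_differentiableOn_of_addHaar_eq_zero _
        (hP₀.differentiable (by norm_num)).differentiableOn
        (Measure.addHaar_sphere_of_ne_zero _ _ hε.ne')
    exact (measure_ball_pos volume (0 : E) (half_pos hδ)).ne' (measure_mono_null h hnull)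
  rw [mem_ball_zero_iff] at hvδ
  have hPG : ∀ y, ‖P₀ y - v - G y‖ < δ := by
    intro y
    have h1 := hP₀G y
    rw [dist_eq_norm] at h1
    calc ‖P₀ y - v - G y‖ = ‖(P₀ y - G y) - v‖ := by congr 1; abel
      _ ≤ ‖P₀ y - G y‖ + ‖v‖ := norm_sub_le _ _
      _ < δ := by linarith
  let Φ : E → E := fun y ↦ c + max (ε / ‖y - c‖) 1 • (y - c)
  have hΦ : ContinuousOn Φ K := by
    have : ∀ y ∈ K, ‖y - c‖ ≠ 0 := fun y hy h ↦
      hcK (by rwa [← sub_eq_zero.1 (norm_eq_zero.1 h)])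
    fun_prop (disch := assumption)
  have hfar : ∀ y, ε ≤ ‖y - c‖ → Φ y = y := by
    intro y hy
    have : ε / ‖y - c‖ ≤ 1 := div_le_one_of_le₀ hy (norm_nonneg _)
    simp [Φ, max_eq_right this]
  have hnear : ∀ y ∈ K, ‖y - c‖ < ε → ‖Φ y - c‖ = ε := by
    intro y hyK hy
    have hpos : 0 < ‖y - c‖ := norm_pos_iff.2 fun h ↦ hcK (by rwa [← sub_eq_zero.1 h])
    have : 1 ≤ ε / ‖y - c‖ := (one_le_div hpos).2 hy.le
    simp only [Φ, add_sub_cancel_left, max_eq_left this, norm_smul, norm_div, norm_norm,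
      Real.norm_of_nonneg hε.le]
    field_simp
  have hne : ∀ y ∈ K, P₀ (Φ y) - v ≠ 0 := by
    intro y hy h
    rcases le_or_gt ε ‖y - c‖ with hyc | hyc
    · have h1 := hPG y
      rw [hfar y hyc] at h
      rw [h, zero_sub, norm_neg] at h1
      exact h1.not_ge (hδS y ⟨hy, hyc⟩)
    · exact hv ⟨Φ y, by rw [mem_sphere, dist_eq_norm]; exact hnear y hy hyc, sub_eq_zero.1 h⟩
  have hclose : ∀ y ∈ K, ‖G y - (P₀ (Φ y) - v)‖ ≤ 1 := by
    intro y hy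
    rcases le_or_gt ε ‖y - c‖ with hyc | hyc
    · rw [hfar y hyc, norm_sub_rev]
      linarith [hPG y]
    · have h1 := hGε y (by linarith [norm_sub_le_norm_sub_add_norm_sub y c (f 0)])
      have h2 := hGε (Φ y) (by
        linarith [norm_sub_le_norm_sub_add_norm_sub (Φ y) c (f 0), hnear y hy hyc])
      have h3 := hPG (Φ y)
      have : G y - (P₀ (Φ y) - v) = G y - G (Φ y) - (P₀ (Φ y) - v - G (Φ y)) := by abel
      rw [this]
      linarith [norm_sub_le (G y - G (Φ y)) (P₀ (Φ y) - v - G (Φ y)), norm_sub_le (G y) (G (Φ y))]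
  obtain ⟨x, hx, hfix⟩ := exists_fixedPoint_closedBall
    (w := fun x ↦ G (f x) - (P₀ (Φ (f x)) - v))
    ((G.continuous.comp_continuousOn hf).sub
      ((hP₀.continuous.comp_continuousOn (hΦ.comp hf (mapsTo_image _ _))).sub continuousOn_const))
    (fun x hx ↦ by simpa using hclose (f x) (mem_image_of_mem f hx))
  simp only [hG x hx, sub_eq_self] at hfix
  exact hne (f x) (mem_image_of_mem f hx) hfix

/-- **Invariance of domain**: a continuous injective map on a neighborhood of `a` sends
neighborhoods of `a` to neighborhoods. -/
theorem nhds_le_map_of_continuousOn_of_injOn {f : E → E} {U : Set E} {a : E} (hU : U ∈ 𝓝 a)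
    (hf : ContinuousOn f U) (hinj : InjOn f U) : 𝓝 (f a) ≤ map f (𝓝 a) := by
  intro N hN
  obtain ⟨r, hr, hrN⟩ := nhds_basis_closedBall.mem_iff.1 (inter_mem hU hN)
  let s : E → E := fun x ↦ a + r • x
  have hs : MapsTo s (closedBall 0 1) (closedBall a r) := by
    intro x hx
    rw [mem_closedBall_zero_iff] at hx
    simp only [s, mem_closedBall, dist_self_add_left, norm_smul, Real.norm_of_nonneg hr.le]
    nlinarith
  have hsinj : Function.Injective s := fun x y h ↦
    smul_right_injective E hr.ne' (add_left_cancel h)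
  have h := image_closedBall_mem_nhds (f := f ∘ s)
    (hf.comp (by fun_prop) fun x hx ↦ (hrN (hs hx)).1)
    (hinj.comp hsinj.injOn fun x hx ↦ (hrN (hs hx)).1)
  simp only [Function.comp_apply, s, smul_zero, add_zero] at h
  refine mem_of_superset h ?_
  rintro _ ⟨x, hx, rfl⟩
  exact (hrN (hs hx)).2

/-- **Invariance of domain** for manifolds of the same dimension. -/
theorem isOpenMap_of_continuous_of_injective {X M : Type*} [TopologicalSpace X] [TopologicalSpace M]
    [ChartedSpace E X] [ChartedSpace E M] {g : X → M} (hg : Continuous g)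
    (hinj : Function.Injective g) : IsOpenMap g := by
  refine IsOpenMap.of_nhds_le fun p ↦ ?_
  let φ := chartAt E p
  let ψ := chartAt E (g p)
  have hp : p ∈ φ.source := mem_chart_source E p
  have hgp : g p ∈ ψ.source := mem_chart_source E (g p)
  let U : Set E := φ.target ∩ φ.symm ⁻¹' (g ⁻¹' ψ.source)
  have hU : U ∈ 𝓝 (φ p) :=
    (φ.symm.isOpen_inter_preimage (ψ.open_source.preimage hg)).mem_nhds
      ⟨φ.map_source hp, by simpa [φ.left_inv hp] using hgp⟩
  have hcont : ContinuousOn (ψ ∘ g ∘ φ.symm) U :=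
    ψ.continuousOn.comp (hg.comp_continuousOn (φ.continuousOn_symm.mono inter_subset_left))
      fun x hx ↦ hx.2
  have hinjU : InjOn (ψ ∘ g ∘ φ.symm) U := fun x hx y hy h ↦
    φ.symm.injOn hx.1 hy.1 (hinj (ψ.injOn hx.2 hy.2 h))
  have h := nhds_le_map_of_continuousOn_of_injOn hU hcont hinjU
  have hval : (ψ ∘ g ∘ φ.symm) (φ p) = ψ (g p) := by simp [φ.left_inv hp]
  rw [hval] at h
  calc 𝓝 (g p) = map ψ.symm (𝓝 (ψ (g p))) := (ψ.symm_map_nhds_eq hgp).symm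
    _ ≤ map ψ.symm (map (ψ ∘ g ∘ φ.symm) (𝓝 (φ p))) := map_mono h
    _ = map g (𝓝 p) := by
      rw [← φ.map_nhds_eq hp, map_map, map_map]
      refine map_congr ?_
      filter_upwards [φ.open_source.mem_nhds hp, (ψ.open_source.preimage hg).mem_nhds hgp]
        with x hx hgx
      simp [φ.left_inv hx, ψ.left_inv hgx]

end Brouwer

section Gluing

variable {E : Type*} [NormedAddCommGroup E] [InnerProductSpace ℝ E]

/-- The Alexander trick: an injective continuous self-map of the unit sphere extends radially to a
norm-preserving injective continuous self-map of the closed unit ball. -/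
theorem exists_radial_extension {φ : sphere (0 : E) 1 → sphere (0 : E) 1} (hφ : Continuous φ)
    (hinj : Function.Injective φ) : ∃ h : closedBall (0 : E) 1 → closedBall (0 : E) 1,
      Continuous h ∧ Function.Injective h ∧ (∀ x, ‖(h x : E)‖ = ‖(x : E)‖) ∧
      ∀ x : sphere (0 : E) 1, h ⟨x, sphere_subset_closedBall x.2⟩ =
        ⟨φ x, sphere_subset_closedBall (φ x).2⟩ := by
  have hdir : ∀ x : E, x ≠ 0 → ‖x‖⁻¹ • x ∈ sphere (0 : E) 1 := fun x hx ↦ by simp [norm_smul, hx]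
  classical
  let H : E → E := fun x ↦ if hx : x = 0 then 0 else ‖x‖ • (φ ⟨‖x‖⁻¹ • x, hdir x hx⟩ : E)
  have hH0 : H 0 = 0 := dif_pos rfl
  have hHx : ∀ x (hx : x ≠ 0), H x = ‖x‖ • (φ ⟨‖x‖⁻¹ • x, hdir x hx⟩ : E) := fun x hx ↦ dif_neg hx
  have hnorm : ∀ x, ‖H x‖ = ‖x‖ := by
    intro x
    rcases eq_or_ne x 0 with rfl | hx
    · simp [hH0]
    · simp [hHx x hx, norm_smul]
  have hHcont : Continuous H := by
    refine continuous_iff_continuousAt.2 fun x ↦ ?_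
    rcases eq_or_ne x 0 with rfl | hx
    · rw [ContinuousAt, hH0, tendsto_zero_iff_norm_tendsto_zero]
      simpa [hnorm] using continuous_norm.tendsto (0 : E)
    · have hon : ContinuousOn H {0}ᶜ := by
        rw [continuousOn_iff_continuous_domRestrict]
        have : ({0}ᶜ : Set E).domRestrict H = fun x : ({0}ᶜ : Set E) ↦
            ‖(x : E)‖ • (φ ⟨‖(x : E)‖⁻¹ • x, hdir x x.2⟩ : E) := funext fun x ↦ hHx x x.2
        rw [this]
        refine continuous_subtype_val.norm.smul (continuous_subtype_val.comp (hφ.comp ?_))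
        refine Continuous.subtype_mk ?_ _
        exact (continuous_subtype_val.norm.inv₀ fun x ↦ norm_ne_zero_iff.2 x.2).smul
          continuous_subtype_val
      exact hon.continuousAt (isOpen_compl_singleton.mem_nhds hx)
  have hHinj : Function.Injective H := by
    intro x y hxy
    have hn : ‖x‖ = ‖y‖ := by rw [← hnorm x, hxy, hnorm]
    rcases eq_or_ne x 0 with rfl | hx
    · exact (norm_eq_zero.1 (by simpa using hn.symm)).symm
    · have hy : y ≠ 0 := norm_ne_zero_iff.1 (hn ▸ norm_ne_zero_iff.2 hx)
      rw [hHx x hx, hHx y hy] at hxy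
      nth_rewrite 1 [hn] at hxy
      have h1 := hinj (Subtype.ext (smul_right_injective E (norm_ne_zero_iff.2 hy) hxy))
      have h2 : ‖x‖⁻¹ • x = ‖y‖⁻¹ • y := congrArg Subtype.val h1
      rw [hn] at h2
      exact smul_right_injective E (inv_ne_zero (norm_ne_zero_iff.2 hy)) h2
  have hmem : ∀ x : closedBall (0 : E) 1, H x ∈ closedBall (0 : E) 1 := fun x ↦ by
    simpa [hnorm] using mem_closedBall_zero_iff.1 x.2
  refine ⟨fun x ↦ ⟨H x, hmem x⟩, (hHcont.comp continuous_subtype_val).subtype_mk hmem,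
    fun x y h ↦ Subtype.ext (hHinj (congrArg Subtype.val h)), fun x ↦ hnorm x, fun x ↦ ?_⟩
  have hx1 : ‖(x : E)‖ = 1 := by simp
  have hx0 : (x : E) ≠ 0 := norm_ne_zero_iff.1 (by rw [hx1]; exact one_ne_zero)
  ext
  simp [hHx _ hx0]

variable {M : Type*} [TopologicalSpace M]

/-- The open unit ball has open image under an embedding of the closed unit ball in a manifold of
the same dimension. -/
theorem isOpen_image_ball [FiniteDimensional ℝ E] [ChartedSpace E M]
    {e : closedBall (0 : E) 1 → M} (he : IsEmbedding e) :
    IsOpen (e '' {x | ‖(x : E)‖ < 1}) := by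
  let V : TopologicalSpace.Opens E := ⟨ball 0 1, isOpen_ball⟩
  let j : V → M := fun x ↦ e ⟨x, ball_subset_closedBall x.2⟩
  have hj : Continuous j := he.continuous.comp (continuous_subtype_val.subtype_mk _)
  have hjinj : Function.Injective j := fun x y h ↦
    Subtype.ext (congrArg (fun z : closedBall (0 : E) 1 ↦ (z : E)) (he.injective h))
  convert (isOpenMap_of_continuous_of_injective (E := E) hj hjinj).isOpen_range using 1
  ext y
  constructor
  · rintro ⟨x, hx, rfl⟩
    exact ⟨⟨x, mem_ball_zero_iff.2 hx⟩, rfl⟩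
  · rintro ⟨x, rfl⟩
    exact ⟨_, mem_ball_zero_iff.1 x.2, rfl⟩

/-- Two balls in a manifold with the same boundary sphere have equal or disjoint interiors. -/
theorem image_ball_subset_of_inter_nonempty [FiniteDimensional ℝ E] [T2Space M]
    [ChartedSpace E M]
    {e f : closedBall (0 : E) 1 → M} (he : IsEmbedding e) (hf : IsEmbedding f)
    (hef : f '' {x | ‖(x : E)‖ = 1} = e '' {x | ‖(x : E)‖ = 1})
    (hne : (e '' {x | ‖(x : E)‖ < 1} ∩ f '' {x | ‖(x : E)‖ < 1}).Nonempty) :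
    e '' {x | ‖(x : E)‖ < 1} ⊆ f '' {x | ‖(x : E)‖ < 1} := by
  have hconn : IsPreconnected {x : closedBall (0 : E) 1 | ‖(x : E)‖ < 1} := by
    rw [← IsInducing.subtypeVal.isPreconnected_image]
    convert (convex_ball (0 : E) 1).isPreconnected using 1
    ext x
    simpa using fun h : ‖x‖ < 1 ↦ h.le
  refine (hconn.image e he.continuous.continuousOn).subset_of_closure_inter_subset
    (isOpen_image_ball hf) hne ?_
  rintro y ⟨hy, x, hx, rfl⟩
  have : CompactSpace (closedBall (0 : E) 1) :=
    isCompact_iff_compactSpace.1 (isCompact_closedBall _ _)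
  obtain ⟨z, hz⟩ : e x ∈ range f := closure_minimal (image_subset_range _ _)
    (isCompact_range hf.continuous).isClosed hy
  rcases (mem_closedBall_zero_iff.1 z.2).lt_or_eq with h | h
  · exact ⟨z, h, hz⟩
  · obtain ⟨x', hx', hxx'⟩ : e x ∈ e '' {x | ‖(x : E)‖ = 1} := hef ▸ ⟨z, h, hz⟩
    rw [he.injective hxx'] at hx'
    exact absurd hx' (ne_of_lt hx)

end Gluing

/-- Two embedded balls with common boundary sphere and disjoint interiors glue to an injective
continuous image of the 3-sphere. -/
theorem exists_injective_sphere_of_balls {M : Type*} [TopologicalSpace M]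
    {e f : closedBall (0 : EuclideanSpace ℝ (Fin 3)) 1 → M} (he : IsEmbedding e)
    (hf : IsEmbedding f)
    (hef : f '' {x | ‖(x : EuclideanSpace ℝ (Fin 3))‖ = 1} =
      e '' {x | ‖(x : EuclideanSpace ℝ (Fin 3))‖ = 1})
    (hdisj : Disjoint (e '' {x | ‖(x : EuclideanSpace ℝ (Fin 3))‖ < 1})
      (f '' {x | ‖(x : EuclideanSpace ℝ (Fin 3))‖ < 1})) :
    ∃ g : sphere (0 : EuclideanSpace ℝ (Fin 4)) 1 → M, Continuous g ∧ Function.Injective g := by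
  let B := closedBall (0 : EuclideanSpace ℝ (Fin 3)) 1
  let ι : sphere (0 : EuclideanSpace ℝ (Fin 3)) 1 → B :=
    fun x ↦ ⟨x, sphere_subset_closedBall x.2⟩
  have hι : Continuous ι := continuous_subtype_val.subtype_mk _
  have hιinj : Function.Injective ι := fun x y h ↦ Subtype.ext (congrArg (fun z : B ↦ z.1) h)
  have hex : ∀ x, ∃ y, f (ι y) = e (ι x) := by
    intro x
    have : e (ι x) ∈ f '' {x | ‖(x : EuclideanSpace ℝ (Fin 3))‖ = 1} :=
      hef ▸ ⟨ι x, mem_sphere_zero_iff_norm.1 x.2, rfl⟩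
    obtain ⟨y, hy, hyx⟩ := this
    exact ⟨⟨y, mem_sphere_zero_iff_norm.2 hy⟩, hyx⟩
  choose φ hφ using hex
  have hφc : Continuous φ := by
    have h1 : IsEmbedding (f ∘ ι) := hf.comp (IsEmbedding.inclusion sphere_subset_closedBall)
    rw [h1.continuous_iff]
    exact (he.continuous.comp hι).congr fun x ↦ (hφ x).symm
  have hφinj : Function.Injective φ := fun x y h ↦
    hιinj (he.injective (by rw [← hφ, ← hφ, h]))
  obtain ⟨h, hh, hhinj, hhnorm, hhφ⟩ := exists_radial_extension hφc hφinj
  let S := sphere (0 : EuclideanSpace ℝ (Fin 4)) 1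
  have hnorm : ∀ p : S, ‖WithLp.toLp 2 (Fin.init (p : EuclideanSpace ℝ (Fin 4)).ofLp)‖ ^ 2
      + (p : EuclideanSpace ℝ (Fin 4)) (Fin.last 3) ^ 2 = 1 := by
    intro p
    have hp : ‖(p : EuclideanSpace ℝ (Fin 4))‖ ^ 2 = 1 := by simp
    rw [EuclideanSpace.real_norm_sq_eq, Fin.sum_univ_castSucc] at hp
    rw [EuclideanSpace.real_norm_sq_eq]
    exact hp
  let π : S → B := fun p ↦ ⟨WithLp.toLp 2 (Fin.init (p : EuclideanSpace ℝ (Fin 4)).ofLp), by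
    rw [mem_closedBall_zero_iff]
    nlinarith [hnorm p, norm_nonneg (WithLp.toLp 2 (Fin.init (p : EuclideanSpace ℝ (Fin 4)).ofLp))]⟩
  let τ : S → ℝ := fun p ↦ (p : EuclideanSpace ℝ (Fin 4)) (Fin.last 3)
  have hπτ : ∀ p, ‖(π p : EuclideanSpace ℝ (Fin 3))‖ ^ 2 + τ p ^ 2 = 1 := hnorm
  have hπ : Continuous π := by
    refine Continuous.subtype_mk ?_ _
    unfold Fin.init
    fun_prop
  have hτ : Continuous τ := by fun_prop
  have hext : ∀ p q, π p = π q → τ p = τ q → p = q := by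
    intro p q h1 h2
    ext i
    refine Fin.lastCases h2 (fun j ↦ ?_) i
    exact congrArg (fun z : B ↦ (z : EuclideanSpace ℝ (Fin 3)) j) h1
  have hsq : ∀ p q, π p = π q → τ p ^ 2 = τ q ^ 2 := fun p q h ↦ by
    have h1 := hπτ p
    rw [h] at h1
    linarith [hπτ q]
  have hlt : ∀ q, τ q < 0 → ‖(π q : EuclideanSpace ℝ (Fin 3))‖ < 1 := fun q hq ↦ by
    nlinarith [hπτ q, norm_nonneg (π q : EuclideanSpace ℝ (Fin 3)), mul_pos_of_neg_of_neg hq hq]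
  have hmixed : ∀ p q, τ q < 0 → e (π p) ≠ f (h (π q)) := by
    intro p q hq hpq
    have hq1 : ‖(h (π q) : EuclideanSpace ℝ (Fin 3))‖ < 1 := by rw [hhnorm]; exact hlt q hq
    rcases (mem_closedBall_zero_iff.1 (π p).2).lt_or_eq with hp | hp
    · exact disjoint_left.1 hdisj ⟨_, hp, rfl⟩ ⟨_, hq1, hpq.symm⟩
    · obtain ⟨z, hz, hzp⟩ : e (π p) ∈ f '' {x | ‖(x : EuclideanSpace ℝ (Fin 3))‖ = 1} :=
        hef ▸ ⟨_, hp, rfl⟩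
      rw [hf.injective (hzp.trans hpq)] at hz
      exact hq1.ne hz
  classical
  refine ⟨fun p ↦ if 0 ≤ τ p then e (π p) else f (h (π p)), ?_, ?_⟩
  · refine Continuous.if_le (he.continuous.comp hπ) (hf.continuous.comp (hh.comp hπ))
      continuous_const hτ fun p hp ↦ ?_
    have hp1 : ‖(π p : EuclideanSpace ℝ (Fin 3))‖ = 1 := by
      have := hπτ p
      rw [← hp] at this
      nlinarith [norm_nonneg (π p : EuclideanSpace ℝ (Fin 3))]
    have h1 := hhφ ⟨π p, mem_sphere_zero_iff_norm.2 hp1⟩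
    change e (π p) = f (h (π p))
    rw [show h (π p) = _ from h1]
    exact (hφ ⟨π p, mem_sphere_zero_iff_norm.2 hp1⟩).symm
  · intro p q hpq
    simp only at hpq
    split_ifs at hpq with hp hq hq
    · have := he.injective hpq
      exact hext p q this ((sq_eq_sq₀ hp hq).1 (hsq p q this))
    · exact absurd hpq (hmixed p q (not_le.1 hq))
    · exact absurd hpq.symm (hmixed q p (not_le.1 hp))
    · have := hhinj (hf.injective hpq)
      refine hext p q this ?_
      have h2 := hsq p q this
      rw [← neg_sq (τ p), ← neg_sq (τ q)] at h2
      linarith [(sq_eq_sq₀ (by linarith) (by linarith)).1 h2]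

/-- A connected Hausdorff 3-manifold into which the 3-sphere maps injectively and continuously is
homeomorphic to the 3-sphere. -/
theorem nonempty_homeomorph_sphere_of_injective {M : Type*} [TopologicalSpace M] [T2Space M]
    [ChartedSpace (EuclideanSpace ℝ (Fin 3)) M] [ConnectedSpace M]
    {g : sphere (0 : EuclideanSpace ℝ (Fin 4)) 1 → M} (hg : Continuous g)
    (hinj : Function.Injective g) :
    Nonempty (M ≃ₜ sphere (0 : EuclideanSpace ℝ (Fin 4)) 1) := by
  have : Fact (Module.finrank ℝ (EuclideanSpace ℝ (Fin 4)) = 3 + 1) := ⟨by simp⟩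
  have hopen : IsOpenMap g :=
    isOpenMap_of_continuous_of_injective (E := EuclideanSpace ℝ (Fin 3)) hg hinj
  have : Nonempty (sphere (0 : EuclideanSpace ℝ (Fin 4)) 1) :=
    ⟨⟨EuclideanSpace.single 0 1, by simp⟩⟩
  have huniv : range g = univ :=
    IsClopen.eq_univ ⟨(isCompact_range hg).isClosed, hopen.isOpen_range⟩ (range_nonempty g)
  exact ⟨((Equiv.ofBijective g ⟨hinj, range_eq_univ.1 huniv⟩).toHomeomorphOfContinuousOpen
    hg hopen).symm⟩


/-- If `M` is a compact, connected topological 3-manifold without boundary not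
homeomorphic to `S³`, and a knot `k` in `M` lies in the image of the open unit
ball under a topological embedding `e` of the closed unit ball of `ℝ³` into
`M`, then `k` is not irreducible: there is an embedded 2-sphere in the
complement of the image of `k` that bounds no ball in that complement. -/
theorem knot_in_ball_not_irreducible
    {M : Type*} [TopologicalSpace M] [T2Space M] [SecondCountableTopology M]
    [ChartedSpace (EuclideanSpace ℝ (Fin 3)) M]
    [CompactSpace M] [ConnectedSpace M]
    (hM : ¬ Nonempty (M ≃ₜ Metric.sphere (0 : EuclideanSpace ℝ (Fin 4)) 1))
    (k : (Metric.sphere (0 : EuclideanSpace ℝ (Fin 2)) 1) → M)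
    (hk : Topology.IsEmbedding k)
    (e : (Metric.closedBall (0 : EuclideanSpace ℝ (Fin 3)) 1) → M)
    (he : Topology.IsEmbedding e)
    (hke : Set.range k ⊆
      e '' {x : (Metric.closedBall (0 : EuclideanSpace ℝ (Fin 3)) 1) |
              ‖(x : EuclideanSpace ℝ (Fin 3))‖ < 1}) :
    ∃ S : (Metric.sphere (0 : EuclideanSpace ℝ (Fin 3)) 1) → M,
      Topology.IsEmbedding S ∧ Set.range S ⊆ (Set.range k)ᶜ ∧
      ¬ ∃ f : (Metric.closedBall (0 : EuclideanSpace ℝ (Fin 3)) 1) → M,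
          Topology.IsEmbedding f ∧
          Set.range f ⊆ (Set.range k)ᶜ ∧
          f '' {x : (Metric.closedBall (0 : EuclideanSpace ℝ (Fin 3)) 1) |
                  ‖(x : EuclideanSpace ℝ (Fin 3))‖ = 1} = Set.range S := by
  let ι : sphere (0 : EuclideanSpace ℝ (Fin 3)) 1 → closedBall (0 : EuclideanSpace ℝ (Fin 3)) 1 :=
    fun x ↦ ⟨x, sphere_subset_closedBall x.2⟩
  have hι : IsEmbedding ι := IsEmbedding.inclusion sphere_subset_closedBall
  have hrange : range (e ∘ ι) = e '' {x | ‖(x : EuclideanSpace ℝ (Fin 3))‖ = 1} := by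
    rw [range_comp]
    congr 1
    ext x
    exact ⟨fun ⟨y, hy⟩ ↦ hy ▸ mem_sphere_zero_iff_norm.1 y.2,
      fun hx ↦ ⟨⟨x, mem_sphere_zero_iff_norm.2 hx⟩, rfl⟩⟩
  refine ⟨e ∘ ι, he.comp hι, ?_, ?_⟩
  · rw [hrange]
    rintro _ ⟨x, hx, rfl⟩ hxk
    obtain ⟨y, hy, hyx⟩ := hke hxk
    rw [he.injective hyx] at hy
    exact absurd hx (ne_of_lt hy)
  · rintro ⟨f, hf, hfk, hfS⟩
    rw [hrange] at hfS
    obtain ⟨g, hg, hginj⟩ := exists_injective_sphere_of_balls he hf hfS (by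
      rw [disjoint_iff_inter_eq_empty, ← not_nonempty_iff_eq_empty]
      intro hne
      let p : sphere (0 : EuclideanSpace ℝ (Fin 2)) 1 := ⟨EuclideanSpace.single 0 1, by simp⟩
      have hp := image_ball_subset_of_inter_nonempty he hf hfS hne (hke (mem_range_self p))
      exact hfk (image_subset_range _ _ hp) (mem_range_self p))
    exact hM (nonempty_homeomorph_sphere_of_injective hg hginj)
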